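/- arXiv:1704.04072 — 5 statements merged into one kernel-verified Lean document; each statement's English description precedes it below -/
import Mathlib

section
/- The ℤ-linear map Id − γ̃ : ℤ[Λ] → ℤ[Λ] sending each basis element λ to λ − γ(λ) induces a ℤ-module isomorphism from J[Λ/R] = coker ν_{Λ/R} onto I[Λ/R] = ker ε_{Λ/R}. -/
open Finsupp LinearMap Function

/-- The set of 2-element subsets of a finite set `X`. -/
abbrev Pairs (X : Type) : Type := {s : Finset X // s.card = 2}

/-- The complement map `γ : Λ → Λ` sending a 2-element subset of a 4-element set to its
complement. -/
def gammaMap (X : Type) [Fintype X] [DecidableEq X] (hX : Fintype.card X = 4) :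
    Pairs X → Pairs X :=
  fun l => ⟨(l : Finset X)ᶜ, by rw [Finset.card_compl, l.2, hX]⟩

/-- The augmentation `ε_E : ℤ[E] → ℤ`. -/
noncomputable def epsAug (E : Type) : (E →₀ ℤ) →ₗ[ℤ] ℤ :=
  Finsupp.lsum ℤ fun _ => LinearMap.id

/-- The norm `ν_E : ℤ → ℤ[E]`, `1 ↦ Σ_{e ∈ E} e`. -/
noncomputable def nuNorm (E : Type) [Fintype E] : ℤ →ₗ[ℤ] (E →₀ ℤ) :=
  ∑ e : E, Finsupp.lsingle e

/-- The relative augmentation `ε_{Λ/R} : ℤ[Λ] → ℤ[R]`, `λ ↦ π(λ)`. -/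
noncomputable def epsRel {Λ R : Type} (π : Λ → R) : (Λ →₀ ℤ) →ₗ[ℤ] (R →₀ ℤ) :=
  Finsupp.lmapDomain ℤ ℤ π

/-- The relative norm `ν_{Λ/R} : ℤ[R] → ℤ[Λ]`, `r ↦ Σ_{π(λ) = r} λ`. -/
noncomputable def nuRel {Λ R : Type} [Fintype Λ] [DecidableEq R] (π : Λ → R) :
    (R →₀ ℤ) →ₗ[ℤ] (Λ →₀ ℤ) :=
  Finsupp.lsum ℤ fun r => ∑ l ∈ Finset.univ.filter fun l => π l = r, Finsupp.lsingle l

/-- The map `σ : ℤ[Λ] → ℤ[X]`, `λ ↦ Σ_{x ∈ λ} x`. -/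
noncomputable def sigmaMap (X : Type) [Fintype X] [DecidableEq X] :
    (Pairs X →₀ ℤ) →ₗ[ℤ] (X →₀ ℤ) :=
  Finsupp.lsum ℤ fun l => ∑ x ∈ (l : Finset X), Finsupp.lsingle x

/-- The map `τ : ℤ[X] → ℤ[Λ]`, `x ↦ Σ_{λ ∋ x} λ`. -/
noncomputable def tauMap (X : Type) [Fintype X] [DecidableEq X] :
    (X →₀ ℤ) →ₗ[ℤ] (Pairs X →₀ ℤ) :=
  Finsupp.lsum ℤ fun x =>
    ∑ l ∈ Finset.univ.filter fun l : Pairs X => x ∈ (l : Finset X), Finsupp.lsingle l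

theorem gamma_gamma (X : Type) [Fintype X] [DecidableEq X] (hX : Fintype.card X = 4)
    (l : Pairs X) : gammaMap X hX (gammaMap X hX l) = l := by
  apply Subtype.ext
  simp [gammaMap]

theorem gamma_ne (X : Type) [Fintype X] [DecidableEq X] (hX : Fintype.card X = 4)
    (l : Pairs X) : gammaMap X hX l ≠ l := by
  intro h
  have h1 : (l : Finset X)ᶜ = l := congrArg Subtype.val h
  have h2 : (l : Finset X).Nonempty := by
    rw [← Finset.card_pos, l.2]; norm_num
  obtain ⟨x, hx⟩ := h2
  have h3 := hx
  rw [← h1, Finset.mem_compl] at h3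
  exact h3 hx

theorem nuRel_apply' {Λ R : Type} [Fintype Λ] [DecidableEq R] (π : Λ → R) (b : R →₀ ℤ) (l : Λ) :
    nuRel π b l = b (π l) := by
  classical
  induction b using Finsupp.induction_linear with
  | zero => simp
  | add f g hf hg => rw [map_add, Finsupp.add_apply, hf, hg, Finsupp.add_apply]
  | single r c =>
    simp [nuRel, Finsupp.finsetSum_apply, Finsupp.single_apply, Finset.sum_ite_eq, eq_comm]

theorem epsRel_apply' {Λ R : Type} [Fintype Λ] [DecidableEq R] (π : Λ → R) (a : Λ →₀ ℤ) (r : R) :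
    epsRel π a r = ∑ l ∈ Finset.univ.filter (fun l => π l = r), a l := by
  classical
  induction a using Finsupp.induction_linear with
  | zero => simp
  | add f g hf hg =>
    rw [map_add, Finsupp.add_apply, hf, hg, ← Finset.sum_add_distrib]; rfl
  | single l c =>
    simp [epsRel, Finsupp.mapDomain_single, Finsupp.single_apply, Finset.sum_ite_eq]

theorem diff_apply' (X : Type) [Fintype X] [DecidableEq X] (hX : Fintype.card X = 4)
    (a : Pairs X →₀ ℤ) (l : Pairs X) :
    (LinearMap.id - Finsupp.lmapDomain ℤ ℤ (gammaMap X hX) :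
            (Pairs X →₀ ℤ) →ₗ[ℤ] (Pairs X →₀ ℤ)) a l = a l - a (gammaMap X hX l) := by
  have hinj : Injective (gammaMap X hX) :=
    (show Involutive (gammaMap X hX) from gamma_gamma X hX).injective
  have h := Finsupp.mapDomain_apply hinj a (gammaMap X hX l)
  rw [gamma_gamma] at h
  simp [h]

/-- The map `Id − γ̃ : ℤ[Λ] → ℤ[Λ]` induces a `ℤ`-module isomorphism from
`J[Λ/R] = coker ν_{Λ/R}` onto `I[Λ/R] = ker ε_{Λ/R}`. -/
theorem statement1 (X R : Type) [Fintype X] [DecidableEq X] [DecidableEq R]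
    (hX : Fintype.card X = 4) (π : Pairs X → R)
    (hπsurj : Surjective π)
    (hπ : ∀ l m : Pairs X, π l = π m ↔ m = l ∨ m = gammaMap X hX l) :
    ∃ e : ((Pairs X →₀ ℤ) ⧸ LinearMap.range (nuRel π)) ≃ₗ[ℤ] LinearMap.ker (epsRel π),
      ∀ α : Pairs X →₀ ℤ,
        (e (Submodule.Quotient.mk α) : Pairs X →₀ ℤ) =
          (LinearMap.id - Finsupp.lmapDomain ℤ ℤ (gammaMap X hX) :
            (Pairs X →₀ ℤ) →ₗ[ℤ] (Pairs X →₀ ℤ)) α := by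
  have hγ := gamma_gamma X hX
  have hne := gamma_ne X hX
  have hπγ : ∀ l, π (gammaMap X hX l) = π l := fun l => ((hπ l _).2 (Or.inr rfl)).symm
  have heps : ∀ (a : Pairs X →₀ ℤ) l, epsRel π a (π l) = a l + a (gammaMap X hX l) := by
    intro a l
    rw [epsRel_apply']
    have : Finset.univ.filter (fun m => π m = π l) = {l, gammaMap X hX l} := by
      ext m
      simp only [Finset.mem_filter, Finset.mem_univ, true_and, Finset.mem_insert,
        Finset.mem_singleton]
      rw [eq_comm, hπ]
    rw [this, Finset.sum_pair (hne l).symm]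
  obtain ⟨s, hs⟩ := hπsurj.hasRightInverse
  have : Finite R := Finite.of_surjective π hπsurj
  set D : (Pairs X →₀ ℤ) →ₗ[ℤ] (Pairs X →₀ ℤ) :=
    LinearMap.id - Finsupp.lmapDomain ℤ ℤ (gammaMap X hX) with hD
  have hDa : ∀ a l, D a l = a l - a (gammaMap X hX l) := diff_apply' X hX
  have hker : LinearMap.range (nuRel π) = LinearMap.ker D := by
    ext a
    rw [LinearMap.mem_range, LinearMap.mem_ker]
    constructor
    · rintro ⟨b, rfl⟩
      ext l
      rw [hDa, nuRel_apply', nuRel_apply', hπγ, sub_self, Finsupp.zero_apply]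
    · intro h
      refine ⟨Finsupp.equivFunOnFinite.symm fun r => a (s r), ?_⟩
      ext l
      rw [nuRel_apply', Finsupp.equivFunOnFinite_symm_apply_apply]
      have h1 := hDa a l
      rw [h, Finsupp.zero_apply] at h1
      rcases (hπ l (s (π l))).1 (hs (π l)).symm with h2 | h2
      · rw [h2]
      · rw [h2]; linarith
  have hrange : LinearMap.range D = LinearMap.ker (epsRel π) := by
    ext a
    rw [LinearMap.mem_range, LinearMap.mem_ker]
    constructor
    · rintro ⟨b, rfl⟩
      ext r
      obtain ⟨l, rfl⟩ := hπsurj r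
      rw [heps, hDa, hDa, hγ, Finsupp.zero_apply]; ring
    · intro h
      refine ⟨Finsupp.equivFunOnFinite.symm fun l => if s (π l) = l then a l else 0, ?_⟩
      ext l
      have h1 := heps a l
      rw [h, Finsupp.zero_apply] at h1
      rw [hDa, Finsupp.equivFunOnFinite_symm_apply_apply,
        Finsupp.equivFunOnFinite_symm_apply_apply, hπγ]
      rcases (hπ l (s (π l))).1 (hs (π l)).symm with h2 | h2
      · rw [h2, if_pos rfl, if_neg (hne l).symm, sub_zero]
      · rw [h2, if_pos rfl, if_neg (hne l)]; linarith
  refine ⟨(Submodule.quotEquivOfEq _ _ hker).trans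
    (D.quotKerEquivRange.trans (LinearEquiv.ofEq _ _ hrange)), fun α => ?_⟩
  rfl
end

section
/- As subgroups of k^×, one has {x ∈ k^× : x² ∈ N(L/k)} = N(K/k) · N(L/k). -/
/-- Hilbert 90 for an involution. -/
lemma h90_invol {F k : Type} [Field k] [Field F] [Algebra k F] (σ : F ≃ₐ[k] F)
    (h2 : ∀ a, σ (σ a) = a) (h1 : σ ≠ 1) (t : F) (ht : t * σ t = 1) :
    ∃ v : F, v ≠ 0 ∧ σ v = t * v := by
  by_contra! hc
  have key : ∀ a : F, a + σ a * σ t = 0 := by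
    intro a
    by_contra h
    apply hc _ h
    rw [map_add, map_mul, h2, h2]
    linear_combination (-σ a) * ht
  have ha := key 1
  rw [map_one, one_mul] at ha
  apply h1
  ext a
  have := key a
  rw [AlgEquiv.one_apply]
  linear_combination (-1 : F) * this + σ a * ha

lemma normK_aux (k L : Type) [Field k] [Field L] [Algebra k L] [IsGalois k L]
    (h4 : Module.finrank k L = 4)
    (θ : L ≃ₐ[k] L) (hθ : ∀ g : L ≃ₐ[k] L, g ∈ Subgroup.zpowers θ)
    (K : IntermediateField k L)
    (hK : K = IntermediateField.fixedField (Subgroup.zpowers (θ ^ 2))) :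
    (∀ a, θ (θ (θ (θ a))) = a) ∧ θ ^ 2 ≠ 1 ∧
    (∀ a, a ∈ K ↔ θ (θ a) = a) ∧
    (∀ a, (∀ g : L ≃ₐ[k] L, g a = a) ↔ θ a = a) ∧
    (∀ y : L, algebraMap k L (Algebra.norm k y) = y * θ y * θ (θ y) * θ (θ (θ y))) ∧
    ∃ σ : K ≃ₐ[k] K, σ ≠ 1 ∧ (∀ y : K, ((σ y : K) : L) = θ y) ∧
      ∀ y : K, algebraMap k L (Algebra.norm k y) = y * θ y := by
  classical
  have : FiniteDimensional k L := Module.finite_of_finrank_pos (by omega)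
  have hcard : Nat.card (L ≃ₐ[k] L) = 4 := by rw [IsGalois.card_aut_eq_finrank, h4]
  have hord : orderOf θ = 4 := by
    rw [← hcard]; exact orderOf_eq_card_of_forall_mem_zpowers hθ
  have h44 : θ ^ 4 = 1 := by rw [← hord]; exact pow_orderOf_eq_one θ
  have hθ2 : θ ^ 2 ≠ 1 := fun h => by
    have := orderOf_dvd_of_pow_eq_one h
    rw [hord] at this; omega
  have hfix : ∀ (g : L ≃ₐ[k] L) (a : L), g a = a → ∀ f ∈ Subgroup.zpowers g, f a = a := by
    intro g a ha f hf
    have : Subgroup.zpowers g ≤ MulAction.stabilizer (L ≃ₐ[k] L) a := by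
      rw [Subgroup.zpowers_le]; exact ha
    exact this hf
  have hmem : ∀ a, a ∈ K ↔ θ (θ a) = a := by
    intro a
    rw [hK, IntermediateField.mem_fixedField_iff]
    constructor
    · intro h
      exact h _ (Subgroup.mem_zpowers _)
    · intro h f hf
      exact hfix (θ ^ 2) a h f hf
  have hθ4 : ∀ a, θ (θ (θ (θ a))) = a := fun a => by
    have := DFunLike.congr_fun h44 a
    exact this
  have hnL : ∀ y : L, algebraMap k L (Algebra.norm k y) = y * θ y * θ (θ y) * θ (θ (θ y)) := by
    intro y
    rw [Algebra.norm_eq_prod_automorphisms]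
    have hu : (Finset.univ : Finset (L ≃ₐ[k] L)) = (Finset.range 4).image (fun i => θ ^ i) := by
      have := IsCyclic.image_range_orderOf hθ
      rw [hord] at this
      exact this.symm
    rw [hu, Finset.prod_image]
    · simp only [Finset.prod_range_succ, Finset.prod_range_zero]
      simp [pow_succ]
    · intro i hi j hj hij
      apply pow_injOn_Iio_orderOf (x := θ) _ _ hij <;> simp_all
  refine ⟨hθ4, hθ2, hmem, fun a => ⟨fun h => h θ, fun h g => hfix θ a h g (hθ g)⟩, hnL, ?_⟩
  have hmap : ∀ a : K, θ a ∈ K := fun a => by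
    rw [hmem, (hmem a).1 a.2]
  let f : K →ₐ[k] K := (θ.toAlgHom.comp K.val).codRestrict K.toSubalgebra hmap
  have hf : ∀ y : K, ((f y : K) : L) = θ y := fun y => rfl
  let σ : K ≃ₐ[k] K := AlgEquiv.ofAlgHom f f
    (by ext a; show ((f (f a) : K) : L) = a; rw [hf, hf]; exact (hmem a).1 a.2)
    (by ext a; show ((f (f a) : K) : L) = a; rw [hf, hf]; exact (hmem a).1 a.2)
  have hσ : ∀ y : K, ((σ y : K) : L) = θ y := fun y => rfl
  have hfs : K.fixingSubgroup = Subgroup.zpowers (θ ^ 2) := by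
    rw [hK]; exact IntermediateField.fixingSubgroup_fixedField _
  have ho2 : orderOf (θ ^ 2) = 2 := by
    apply orderOf_eq_prime
    · rw [← pow_mul, h44]
    · exact hθ2
  have hσ1 : σ ≠ 1 := by
    intro h
    have hm : θ ∈ K.fixingSubgroup := by
      rw [IntermediateField.mem_fixingSubgroup_iff]
      intro x hx
      rw [← hσ ⟨x, hx⟩, h]; rfl
    rw [hfs] at hm
    have := Subgroup.orderOf_dvd_natCard _ hm
    rw [Nat.card_zpowers, ho2, hord] at this
    omega
  refine ⟨σ, hσ1, hσ, fun y => ?_⟩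
  have hKL : Module.finrank K L = 2 := by
    rw [hK, IntermediateField.finrank_fixedField_eq_card, Nat.card_zpowers, ho2]
  have hkK : Module.finrank k K = 2 := by
    have := Module.finrank_mul_finrank k K L
    rw [hKL, h4] at this; omega
  have hle : Fintype.card (K ≃ₐ[k] K) ≤ 2 := by
    have := AlgEquiv.card_le (F := k) (K := K)
    rwa [hkK] at this
  have hu : ({1, σ} : Finset (K ≃ₐ[k] K)) = Finset.univ := by
    apply Finset.eq_univ_of_card
    have h1 : ({1, σ} : Finset (K ≃ₐ[k] K)).card = 2 := Finset.card_pair hσ1.symm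
    have := Finset.card_le_univ ({1, σ} : Finset (K ≃ₐ[k] K))
    omega
  have hg : IsGalois k K := by
    apply IsGalois.of_card_aut_eq_finrank
    rw [hkK, Nat.card_eq_fintype_card, ← Finset.card_univ, ← hu, Finset.card_pair hσ1.symm]
  have hn := Algebra.norm_eq_prod_automorphisms k y
  rw [← hu, Finset.prod_pair hσ1.symm] at hn
  have := congrArg (algebraMap K L) hn
  rw [← IsScalarTower.algebraMap_apply, map_mul] at this
  exact this

/-- Let `L/k` be a cyclic Galois extension of degree 4, `θ` a generator of the Galois group,
and `K = L^{⟨θ²⟩}` the unique quadratic intermediate field. Then, as subgroups of `k^×`,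
`{x ∈ k^× : x² ∈ N(L/k)} = N(K/k) · N(L/k)`. -/
theorem statement11 (k L : Type) [Field k] [Field L] [Algebra k L] [IsGalois k L]
    (h4 : Module.finrank k L = 4)
    (θ : L ≃ₐ[k] L) (hθ : ∀ g : L ≃ₐ[k] L, g ∈ Subgroup.zpowers θ)
    (K : IntermediateField k L)
    (hK : K = IntermediateField.fixedField (Subgroup.zpowers (θ ^ 2))) :
    ∀ x : k, x ≠ 0 →
      ((∃ y : L, y ≠ 0 ∧ Algebra.norm k y = x ^ 2) ↔
        ∃ (y₁ : ↥K) (y₂ : L), y₁ ≠ 0 ∧ y₂ ≠ 0 ∧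
          x = Algebra.norm k y₁ * Algebra.norm k y₂) := by
  intro x hx
  obtain ⟨hθ4, hθ2, hmem, hfix, hnL, σ, hσ1, hσ, hnK⟩ := normK_aux k L h4 θ hθ K hK
  have : FiniteDimensional k L := Module.finite_of_finrank_pos (by omega)
  have hinj := (algebraMap k L).injective
  have hX : algebraMap k L x ≠ 0 := by simpa using hx
  constructor
  · rintro ⟨y, hy, hyx⟩
    have hN := hnL y
    rw [hyx, map_pow] at hN
    have hθx : ∀ g : L ≃ₐ[k] L, g (algebraMap k L x) = algebraMap k L x := fun g => g.commutes x
    have hz : y * θ (θ y) / algebraMap k L x ∈ K := by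
      rw [hmem]
      simp only [map_div₀, map_mul, hθx, hθ4]
      rw [mul_comm]
    have hσ2 : ∀ a, σ (σ a) = a := fun a => by
      apply Subtype.ext
      rw [hσ, hσ]; exact (hmem a).1 a.2
    obtain ⟨w, hw0, hw⟩ := h90_invol σ hσ2 hσ1 ⟨_, hz⟩ (by
      apply Subtype.ext
      show y * θ (θ y) / algebraMap k L x * ((σ ⟨_, hz⟩ : K) : L) = 1
      rw [hσ]
      simp only [map_div₀, map_mul, hθx]
      field_simp
      rw [hN]; ring)
    have hw' : θ (w : L) = y * θ (θ y) / algebraMap k L x * w := by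
      rw [← hσ, hw]; rfl
    have hwL : (w : L) ≠ 0 := by simpa using hw0
    have hwK := (hmem w).1 w.2
    -- u = y * w
    have hu0 : y * (w : L) ≠ 0 := mul_ne_zero hy hwL
    generalize hu : y * (w : L) = u at hu0
    have hc : u * θ (θ u) = algebraMap k L (x * Algebra.norm k w) := by
      rw [← hu, map_mul, map_mul, hwK, map_mul, hnK, hw']
      field_simp
    have hcθ : θ u * θ (θ (θ u)) = u * θ (θ u) := by
      rw [← map_mul, hc, θ.commutes]
    have hθu : θ (θ u) ≠ 0 := by simpa using hu0
    obtain ⟨v, hv0, hv⟩ := h90_invol (θ ^ 2) (fun a => hθ4 a) hθ2 (θ u / u) (by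
      show θ u / u * θ (θ (θ u / u)) = 1
      rw [map_div₀, map_div₀]
      field_simp
      exact hcθ)
    have hv' : θ (θ v) = θ u / u * v := hv
    have hθv : θ v ≠ 0 := by simpa using hv0
    have hθu1 : θ u ≠ 0 := by simpa using hu0
    have he : θ (u / (v * θ v)) = u / (v * θ v) := by
      rw [map_div₀, map_mul, hv']
      field_simp
    obtain ⟨e, hee⟩ := (IsGalois.mem_range_algebraMap_iff_fixed (F := k) (u / (v * θ v))).2
      ((hfix _).2 he)
    have hue : u = algebraMap k L e * (v * θ v) := by
      rw [hee]; field_simp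
    have he0 : e ≠ 0 := by
      rintro rfl
      apply hu0; rw [hue]; simp
    have hfin : x * Algebra.norm k w = e ^ 2 * Algebra.norm k v := by
      apply hinj
      rw [← hc, hue]
      simp only [map_mul, map_pow, hnL, θ.commutes]
      ring
    have hnw : Algebra.norm k w ≠ 0 := by
      intro h
      have := hnK w
      rw [h, map_zero] at this
      have h3 : θ (w : L) ≠ 0 := by simpa using hwL
      exact mul_ne_zero hwL h3 this.symm
    refine ⟨algebraMap k K e * w⁻¹, v, mul_ne_zero (by simpa using he0) (inv_ne_zero hw0), hv0, ?_⟩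
    have h1 : Algebra.norm k (algebraMap k K e) = e ^ 2 := by
      apply hinj
      rw [hnK, map_pow]
      show algebraMap k L e * θ (algebraMap k L e) = _
      rw [θ.commutes]; ring
    have h5 : Algebra.norm k w⁻¹ = (Algebra.norm k w)⁻¹ := by
      apply eq_inv_of_mul_eq_one_left
      rw [← map_mul, inv_mul_cancel₀ hw0, map_one]
    rw [map_mul, h1, h5]
    field_simp
    exact hfin
  · rintro ⟨y₁, y₂, h1, h2, rfl⟩
    have h1L : (y₁ : L) ≠ 0 := by simpa using h1
    refine ⟨y₁ * y₂ ^ 2, mul_ne_zero h1L (pow_ne_zero 2 h2), ?_⟩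
    have h3 : Algebra.norm k (y₁ : L) = Algebra.norm k y₁ ^ 2 := by
      apply hinj
      rw [hnL, map_pow, hnK, (hmem y₁).1 y₁.2]; ring
    rw [map_mul, map_pow, h3]; ring
end

section
/- As subgroups of k^×, one has {x ∈ k^× : x ∈ N(K/k) and x, viewed in K, lies in N_{L/K}(L^×)} = k^{×2} · N(L/k). -/
/-- Norm as a product over the powers of a generator. -/
theorem norm_eq_aux (F L : Type) [Field F] [Field L] [Algebra F L] [IsGalois F L]
    [FiniteDimensional F L] (θ : L ≃ₐ[F] L) (hθ : ∀ g : L ≃ₐ[F] L, g ∈ Subgroup.zpowers θ)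
    (z : L) :
    algebraMap F L (Algebra.norm F z)
      = ∏ i ∈ Finset.range (Module.finrank F L), (θ ^ i) z := by
  classical
  have hc : Nat.card (L ≃ₐ[F] L) = Module.finrank F L := IsGalois.card_aut_eq_finrank F L
  have ho : orderOf θ = Module.finrank F L := by
    rw [← hc]; exact orderOf_eq_card_of_forall_mem_zpowers hθ
  rw [Algebra.norm_eq_prod_automorphisms, ← IsCyclic.image_range_card hθ, Finset.prod_image, hc]
  intro i hi j hj hij
  rw [hc, ← ho] at hi hj
  exact pow_injOn_Iio_orderOf (by simpa using hi) (by simpa using hj) hij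

/-- Let `L/k` be a cyclic Galois extension of degree 4, `θ` a generator of the Galois group,
and `K = L^{⟨θ²⟩}` the unique quadratic intermediate field. Then, as subgroups of `k^×`,
`{x ∈ k^× : x ∈ N(K/k) and x ∈ N_{L/K}(L^×)} = k^{×2} · N(L/k)`. -/
theorem statement12 (k L : Type) [Field k] [Field L] [Algebra k L] [IsGalois k L]
    (h4 : Module.finrank k L = 4)
    (θ : L ≃ₐ[k] L) (hθ : ∀ g : L ≃ₐ[k] L, g ∈ Subgroup.zpowers θ)
    (K : IntermediateField k L)
    (hK : K = IntermediateField.fixedField (Subgroup.zpowers (θ ^ 2))) :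
    ∀ x : k, x ≠ 0 →
      (((∃ y : ↥K, y ≠ 0 ∧ Algebra.norm k y = x) ∧
        (∃ z : L, z ≠ 0 ∧ Algebra.norm ↥K z = algebraMap k ↥K x)) ↔
        ∃ (c : k) (w : L), c ≠ 0 ∧ w ≠ 0 ∧ x = c ^ 2 * Algebra.norm k w) := by
  have hfd : FiniteDimensional k L := FiniteDimensional.of_finrank_pos (by omega)
  have ho : orderOf θ = 4 := by
    rw [← h4, ← IsGalois.card_aut_eq_finrank k L]
    exact orderOf_eq_card_of_forall_mem_zpowers hθ
  have ho2 : orderOf (θ ^ 2) = 2 := by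
    rw [orderOf_pow, ho]; norm_num
  have hKL : Module.finrank K L = 2 := by
    rw [hK, IntermediateField.finrank_fixedField_eq_card, Nat.card_zpowers, ho2]
  have hkK : Module.finrank k K = 2 := by
    have := Module.finrank_mul_finrank k K L
    rw [hKL, h4] at this
    omega
  have hfix : ∀ a : K, (θ ^ 2) (a : L) = a := by
    intro a
    have ha : (a : L) ∈ IntermediateField.fixedField (Subgroup.zpowers (θ ^ 2)) := hK ▸ a.2
    rw [IntermediateField.mem_fixedField_iff] at ha
    exact ha _ (Subgroup.mem_zpowers _)
  let τ : L ≃ₐ[K] L := AlgEquiv.ofRingEquiv (f := (θ ^ 2).toRingEquiv) (fun a => hfix a)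
  have hτ : ∀ z, τ z = θ (θ z) := fun z => rfl
  have hτ1 : τ ≠ 1 := by
    intro h
    have : θ ^ 2 = 1 := by
      ext z
      exact congrArg (fun g : L ≃ₐ[K] L => g z) h
    rw [this] at ho2
    simp at ho2
  have hcK : Nat.card (L ≃ₐ[K] L) = 2 := by rw [IsGalois.card_aut_eq_finrank, hKL]
  have hτg : ∀ g : L ≃ₐ[K] L, g ∈ Subgroup.zpowers τ := by
    have : Fact (Nat.Prime 2) := ⟨Nat.prime_two⟩
    intro g
    exact mem_zpowers_of_prime_card hcK hτ1
  have NK : ∀ z : L, algebraMap K L (Algebra.norm K z) = z * θ (θ z) := by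
    intro z
    rw [norm_eq_aux K L τ hτg z, hKL]
    simp [Finset.prod_range_succ, hτ]
  have Nk : ∀ z : L, algebraMap k L (Algebra.norm k z)
      = z * θ z * θ (θ z) * θ (θ (θ z)) := by
    intro z
    rw [norm_eq_aux k L θ hθ z, h4]
    simp [Finset.prod_range_succ, pow_succ]
  have t4 : ∀ z : L, θ (θ (θ (θ z))) = z := by
    intro z
    have h : θ ^ 4 = 1 := by rw [← ho]; exact pow_orderOf_eq_one θ
    have := congrArg (fun g : L ≃ₐ[k] L => g z) h
    simpa [pow_succ] using this
  intro x hx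
  constructor
  · rintro ⟨-, z, hz, hzx⟩
    have e1 : z * θ (θ z) = algebraMap k L x := by
      rw [← NK, hzx]; rfl
    have e2 : θ z * θ (θ (θ z)) = algebraMap k L x := by
      rw [← map_mul, e1]; simp
    have hz1 : θ z ≠ 0 := by simpa using hz
    have hz2 : θ (θ z) ≠ 0 := by simpa using hz
    have hz3 : θ (θ (θ z)) ≠ 0 := by simpa using hz
    -- Hilbert 90
    obtain ⟨t, ht, htu⟩ : ∃ t : L, t ≠ 0 ∧ z * θ (θ t) = t * θ z := by
      have key2 : ∀ a : L, z * θ (θ (a + z / θ z * θ (θ a)))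
          = (a + z / θ z * θ (θ a)) * θ z := by
        intro a
        simp only [map_add, map_mul, map_div₀, t4]
        field_simp
        linear_combination a * (e1 - e2)
      by_contra hcon
      push Not at hcon
      have hall : ∀ a : L, a + z / θ z * θ (θ a) = 0 := by
        intro a
        by_contra hne
        exact hcon _ hne (key2 a)
      have h1 := hall 1
      simp only [map_one, mul_one] at h1
      apply hτ1
      ext a
      rw [hτ]
      have := hall a
      simp only [AlgEquiv.one_apply]
      linear_combination θ (θ a) * h1 - this
    have ht1 : θ t ≠ 0 := by simpa using ht
    have ht2 : θ (θ t) ≠ 0 := by simpa using ht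
    have hcfix : θ (z / (t * θ t)) = z / (t * θ t) := by
      simp only [map_mul, map_div₀]
      field_simp
      linear_combination -htu
    have hmem : z / (t * θ t) ∈ Set.range (algebraMap k L) := by
      rw [IsGalois.mem_range_algebraMap_iff_fixed]
      intro g
      have hle : Subgroup.zpowers θ ≤ MulAction.stabilizer (L ≃ₐ[k] L) (z / (t * θ t)) := by
        rw [Subgroup.zpowers_le]
        exact hcfix
      exact hle (hθ g)
    obtain ⟨c, hc⟩ := hmem
    have hzc : z = algebraMap k L c * (t * θ t) := by
      rw [hc]; field_simp
    refine ⟨c, t, ?_, ht, ?_⟩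
    · rintro rfl
      apply hz
      rw [hzc]; simp
    · apply (algebraMap k L).injective
      rw [map_mul, Nk, ← e1, hzc]
      simp only [map_mul, map_pow, AlgEquiv.commutes]
      ring
  · rintro ⟨c, w, hc, hw, rfl⟩
    refine ⟨⟨algebraMap k K c * Algebra.norm K w, ?_, ?_⟩,
      ⟨algebraMap k L c * (w * θ w), ?_, ?_⟩⟩
    · exact mul_ne_zero (by simpa using hc) (Algebra.norm_ne_zero_iff.mpr hw)
    · rw [map_mul, Algebra.norm_algebraMap, Algebra.norm_norm, hkK]
    · exact mul_ne_zero (by simpa using hc) (mul_ne_zero hw (by simpa using hw))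
    · apply (algebraMap K L).injective
      rw [NK, ← IsScalarTower.algebraMap_apply, map_mul (algebraMap k L), Nk]
      simp only [map_mul, map_pow, AlgEquiv.commutes]
      ring
end

section
/- If y₁ ∈ K^× and y₂ ∈ L^× satisfy N_{K/k}(y₁) = N_{L/K}(y₂) (an equality in K, the left-hand side lying in k ⊆ K), then there exist λ ∈ k^× and x ∈ L^× such that y₁ = λ · N_{L/K}(x) and y₂ = λ · x · θ(x). -/
theorem aux_norm_two {E F : Type*} [Field E] [Field F] [Algebra E F] [FiniteDimensional E F]
    [IsGalois E F] (h : Module.finrank E F = 2) (σ : F ≃ₐ[E] F) (hσ : σ ≠ 1) (x : F) :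
    algebraMap E F (Algebra.norm E x) = x * σ x := by
  classical
  rw [Algebra.norm_eq_prod_automorphisms]
  have hc : Fintype.card (F ≃ₐ[E] F) = 2 := by
    rw [← Nat.card_eq_fintype_card, IsGalois.card_aut_eq_finrank, h]
  have hu : (Finset.univ : Finset (F ≃ₐ[E] F)) = {1, σ} := by
    symm
    apply Finset.eq_univ_of_card
    rw [Finset.card_pair hσ.symm, hc]
  rw [hu, Finset.prod_pair hσ.symm]
  simp

theorem statement13 (k L : Type) [Field k] [Field L] [Algebra k L] [IsGalois k L]
    (h4 : Module.finrank k L = 4)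
    (θ : L ≃ₐ[k] L) (hθ : ∀ g : L ≃ₐ[k] L, g ∈ Subgroup.zpowers θ)
    (K : IntermediateField k L)
    (hK : K = IntermediateField.fixedField (Subgroup.zpowers (θ ^ 2)))
    (y₁ : ↥K) (y₂ : L) (hy₁ : y₁ ≠ 0) (hy₂ : y₂ ≠ 0)
    (hnorm : algebraMap k ↥K (Algebra.norm k y₁) = Algebra.norm ↥K y₂) :
    ∃ (lam : k) (x : L), lam ≠ 0 ∧ x ≠ 0 ∧
      y₁ = algebraMap k ↥K lam * Algebra.norm ↥K x ∧
      y₂ = algebraMap k L lam * (x * θ x) := by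
  classical
  have hfd : FiniteDimensional k L := Module.finite_of_finrank_pos (by omega)
  have hord : orderOf θ = 4 := by
    rw [orderOf_eq_card_of_forall_mem_zpowers hθ, IsGalois.card_aut_eq_finrank, h4]
  have hord2 : orderOf (θ ^ 2) = 2 := by
    rw [orderOf_pow, hord]
    norm_num
  have hfixK : ∀ x : L, x ∈ K ↔ θ (θ x) = x := by
    intro x
    subst hK
    rw [IntermediateField.mem_fixedField_iff]
    constructor
    · intro h
      exact h (θ ^ 2) (Subgroup.mem_zpowers _)
    · intro h f hf
      have hs : θ ^ 2 ∈ MulAction.stabilizer (L ≃ₐ[k] L) x := h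
      have := (Subgroup.zpowers_le.mpr hs) hf
      exact this
  have hLK : Module.finrank K L = 2 := by
    rw [hK, IntermediateField.finrank_fixedField_eq_card, Nat.card_zpowers, hord2]
  have hKk : Module.finrank k K = 2 := by
    have := Module.finrank_mul_finrank k K L
    rw [hLK, h4] at this
    omega
  have hcomm : ∀ g h : L ≃ₐ[k] L, g * h = h * g := by
    intro g h
    obtain ⟨m, rfl⟩ := hθ g
    obtain ⟨n, rfl⟩ := hθ h
    exact zpow_mul_comm θ m n
  have hnorm' : (Subgroup.zpowers (θ ^ 2)).Normal :=
    ⟨fun n hn g => by rw [hcomm g n]; simpa using hn⟩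
  have hGal : IsGalois k K := by
    subst hK
    exact IsGalois.of_fixedField_normal_subgroup _
  let τ : L ≃ₐ[K] L := AlgEquiv.ofRingEquiv (f := (θ ^ 2 : L ≃ₐ[k] L).toRingEquiv)
    (fun x => (hfixK x).1 x.2)
  have hτa : ∀ x, τ x = θ (θ x) := fun x => rfl
  have hτ : τ ≠ 1 := by
    intro h
    have h1 : θ ^ 2 = 1 := by
      ext x
      exact DFunLike.congr_fun h x
    rw [h1, orderOf_one] at hord2
    omega
  let σ : K ≃ₐ[k] K := θ.restrictNormal K
  have hσa : ∀ x : K, ((σ x : K) : L) = θ x := fun x => θ.restrictNormal_commutes K x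
  have hσ : σ ≠ 1 := by
    intro h
    have h1 : K ≤ ⊥ := by
      intro x hx
      rw [IntermediateField.mem_bot, IsGalois.mem_range_algebraMap_iff_fixed]
      intro f
      have hs : θ ∈ MulAction.stabilizer (L ≃ₐ[k] L) x := by
        have := hσa ⟨x, hx⟩
        rw [h] at this
        exact this.symm
      exact (Subgroup.zpowers_le.mpr hs) (hθ f)
    have h2 := le_bot_iff.mp h1
    rw [IntermediateField.finrank_eq_one_iff.mpr h2] at hKk
    omega
  have nLK : ∀ x : L, ((Algebra.norm K x : K) : L) = x * θ (θ x) :=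
    fun x => aux_norm_two hLK τ hτ x
  have nKk : ∀ x : K, algebraMap k K (Algebra.norm k x) = x * σ x :=
    fun x => aux_norm_two hKk σ hσ x
  have ha : (y₁ : L) ≠ 0 := by simpa using hy₁
  have hab : (y₁ : L) * θ y₁ = y₂ * θ (θ y₂) := by
    rw [← nLK, ← hnorm, nKk]
    simp [hσa]
  have haa : θ (θ (y₁ : L)) = y₁ := (hfixK _).1 y₁.2
  have hθa : θ (y₁ : L) ≠ 0 := by simpa using hy₁
  have hnc : Algebra.norm K (y₂ / (y₁ : L)) = σ y₁ / y₁ := by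
    apply Subtype.ext
    rw [nLK]
    push_cast
    rw [hσa, map_div₀, map_div₀, haa]
    field_simp
    linear_combination -hab
  have hn1 : Algebra.norm k (y₂ / (y₁ : L)) = 1 := by
    rw [← Algebra.norm_norm (S := K), hnc]
    apply (algebraMap k K).injective
    rw [nKk, map_one]
    apply Subtype.ext
    push_cast
    rw [hσa, hσa]
    push_cast
    rw [map_div₀, hσa, haa]
    field_simp
  have hcyc : IsCyclic (L ≃ₐ[k] L) := ⟨θ, hθ⟩
  obtain ⟨z, hz⟩ := groupCohomology.exists_div_of_norm_eq_one hθ hn1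
  obtain ⟨x, hx⟩ := θ.surjective (z : L)
  have hx0 : x ≠ 0 := by
    rintro rfl
    rw [map_zero] at hx
    exact z.ne_zero hx.symm
  have h1 : θ x ≠ 0 := by simpa using hx0
  have h2 : θ (θ x) ≠ 0 := by simpa using hx0
  have h3 : θ (θ (θ x)) ≠ 0 := by simpa using hx0
  have hx4 : θ (θ (θ (θ x))) = x := by
    have := pow_orderOf_eq_one θ
    rw [hord] at this
    exact DFunLike.congr_fun this x
  rw [← hx] at hz
  have hb : y₂ = y₁ * θ x / θ (θ x) := by
    field_simp at hz ⊢
    linear_combination -hz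
  have hrel : (y₁ : L) * (θ x * θ (θ (θ x))) = θ y₁ * (x * θ (θ x)) := by
    rw [hb] at hab
    simp only [map_div₀, map_mul, haa, hx4] at hab
    field_simp at hab
    linear_combination -hab
  have hfix : (y₁ : L) / (x * θ (θ x)) ∈ Set.range (algebraMap k L) := by
    rw [IsGalois.mem_range_algebraMap_iff_fixed]
    intro f
    have hs : θ ∈ MulAction.stabilizer (L ≃ₐ[k] L) ((y₁ : L) / (x * θ (θ x))) := by
      change θ ((y₁ : L) / (x * θ (θ x))) = _
      rw [map_div₀, map_mul, div_eq_div_iff (mul_ne_zero h1 h3) (mul_ne_zero hx0 h2)]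
      exact hrel.symm
    exact (Subgroup.zpowers_le.mpr hs) (hθ f)
  obtain ⟨lam, hlam⟩ := hfix
  refine ⟨lam, x, ?_, hx0, ?_, ?_⟩
  · rintro rfl
    rw [map_zero] at hlam
    exact div_ne_zero ha (mul_ne_zero hx0 h2) hlam.symm
  · apply Subtype.ext
    change (y₁ : L) = algebraMap k L lam * ((Algebra.norm K x : K) : L)
    rw [nLK, hlam]
    field_simp
  · rw [hlam, hb]
    field_simp
end

section
/- Let x₁, x₂, x₃ ∈ k^×. If the tensor product of k-algebras (a, x₁)_k ⊗_k (b, x₂)_k ⊗_k (ab, x₃)_k is isomorphic, as a k-algebra, to the algebra of 8×8 matrices over k (i.e. the sum of the three quaternion classes vanishes in the Brauer group of k), then there exists λ ∈ k^× such that (a, x₁)_k ≅ (a, λ)_k, (b, x₂)_k ≅ (b, λ)_k and (ab, x₃)_k ≅ (ab, λ)_k as k-algebras (a common slot theorem). -/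
open scoped Quaternion TensorProduct

/-- Changing the second slot by a norm. -/
lemma quat_iso {k : Type} [Field k] (a x l m n : k) (ha : a ≠ 0) (hx : x ≠ 0)
    (h : x = l * (m ^ 2 - a * n ^ 2)) :
    Nonempty (ℍ[k, a, x] ≃ₐ[k] ℍ[k, a, l]) := by
  let q : QuaternionAlgebra.Basis ℍ[k, a, l] a 0 x :=
    { i := ⟨0, 1, 0, 0⟩
      j := ⟨0, 0, m, n⟩
      k := ⟨0, 0, a * n, m⟩
      i_mul_i := by ext <;> simp
      j_mul_j := by ext <;> simp [h] <;> ring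
      i_mul_j := by ext <;> simp
      j_mul_i := by ext <;> simp }
  have hN : m ^ 2 - a * n ^ 2 ≠ 0 := by
    rintro h0
    apply hx
    rw [h, h0, mul_zero]
  have hinj : Function.Injective q.liftHom := by
    rw [injective_iff_map_eq_zero]
    intro z hz
    have h1 := congrArg QuaternionAlgebra.re hz
    have h2 := congrArg QuaternionAlgebra.imI hz
    have h3 := congrArg QuaternionAlgebra.imJ hz
    have h4 := congrArg QuaternionAlgebra.imK hz
    simp [QuaternionAlgebra.Basis.lift, q] at h1 h2 h3 h4
    have h5 : z.imJ * (m ^ 2 - a * n ^ 2) = 0 := by linear_combination m * h3 - a * n * h4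
    have h6 : z.imK * (m ^ 2 - a * n ^ 2) = 0 := by linear_combination m * h4 - n * h3
    have h5' := (mul_eq_zero.mp h5).resolve_right hN
    have h6' := (mul_eq_zero.mp h6).resolve_right hN
    ext <;> simp [h1, h2, h5', h6']
  have hsurj : Function.Surjective q.liftHom := by
    have := (LinearMap.injective_iff_surjective_of_finrank_eq_finrank
      (f := q.liftHom.toLinearMap)
      (by rw [QuaternionAlgebra.finrank_eq_four, QuaternionAlgebra.finrank_eq_four])).1 hinj
    exact this
  exact ⟨AlgEquiv.ofBijective q.liftHom ⟨hinj, hsurj⟩⟩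

lemma factor_aux {k : Type} [Field k] (a p0 p1 p2 p3 : k) (ha : a ≠ 0)
    (h : p0 * p2 = a * p1 * p3) :
    ∃ u w m n : k, p0 = u * m ∧ p1 = u * n ∧ p2 = w * a * n ∧ p3 = w * m := by
  by_cases h0 : p0 = 0
  · by_cases h3 : p3 = 0
    · exact ⟨a * p1, p2, 0, a⁻¹, by simp [h0], by field_simp, by field_simp, by simp [h3]⟩
    · have h1 : p1 = 0 := by
        have : p1 * (a * p3) = 0 := by rw [h0] at h; linear_combination -h
        exact (mul_eq_zero.mp this).resolve_right (mul_ne_zero ha h3)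
      exact ⟨p0, p3, 1, p2 / (a * p3), by simp, by simp [h0, h1], by field_simp, by simp⟩
  · refine ⟨p0, p3, 1, p1 / p0, by simp, by field_simp, ?_, by simp⟩
    field_simp
    linear_combination h

/-- The field-theoretic part. -/
lemma final_aux {k : Type} [Field k] (h2 : (2 : k) ≠ 0) (a b : k) (ha : a ≠ 0) (hb : b ≠ 0)
    (x₁ x₂ x₃ : k) (hx₁ : x₁ ≠ 0) (hx₂ : x₂ ≠ 0) (hx₃ : x₃ ≠ 0)
    (u w m n us ws ms ns : k)
    (hc : (u ^ 2 - a * b * w ^ 2) * (m ^ 2 - a * n ^ 2) = x₁ * x₃)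
    (hd : (us ^ 2 - a * b * ws ^ 2) * (ms ^ 2 - b * ns ^ 2) = x₂ * x₃)
    (e0 : (w * us - u * ws) * (m * ms) = 0)
    (e1 : (w * us - u * ws) * (n * ms) = 0)
    (e2 : (w * us - u * ws) * (m * ns) = 0)
    (e3 : (w * us - u * ws) * (n * ns) = 0) :
    ∃ lam : k, lam ≠ 0 ∧
      Nonempty (ℍ[k, a, x₁] ≃ₐ[k] ℍ[k, a, lam]) ∧
      Nonempty (ℍ[k, b, x₂] ≃ₐ[k] ℍ[k, b, lam]) ∧
      Nonempty (ℍ[k, a * b, x₃] ≃ₐ[k] ℍ[k, a * b, lam]) := by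
  have hc0 : (u ^ 2 - a * b * w ^ 2) * (m ^ 2 - a * n ^ 2) ≠ 0 := hc ▸ mul_ne_zero hx₁ hx₃
  have hd0 : (us ^ 2 - a * b * ws ^ 2) * (ms ^ 2 - b * ns ^ 2) ≠ 0 := hd ▸ mul_ne_zero hx₂ hx₃
  have hmu := left_ne_zero_of_mul hc0
  have hal := right_ne_zero_of_mul hc0
  have hbe := right_ne_zero_of_mul hd0
  have hprop : w * us - u * ws = 0 := by
    by_contra hne
    have f0 := (mul_eq_zero.mp e0).resolve_left hne
    have f1 := (mul_eq_zero.mp e1).resolve_left hne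
    have f2 := (mul_eq_zero.mp e2).resolve_left hne
    have f3 := (mul_eq_zero.mp e3).resolve_left hne
    have : (m ^ 2 - a * n ^ 2) * (ms ^ 2 - b * ns ^ 2) = 0 := by
      linear_combination (m * ms) * f0 - b * (m * ns) * f2 - a * (n * ms) * f1
        + a * b * (n * ns) * f3
    exact mul_ne_zero hal hbe this
  obtain ⟨r, hu, hw⟩ : ∃ r, us = r * u ∧ ws = r * w := by
    by_cases hu0 : u = 0
    · have hw0 : w ≠ 0 := by
        rintro rfl
        apply hmu
        simp [hu0]
      refine ⟨ws / w, ?_, by field_simp⟩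
      field_simp
      linear_combination hprop
    · refine ⟨us / u, by field_simp, ?_⟩
      field_simp
      linear_combination -hprop
  refine ⟨x₃ * (u ^ 2 - a * b * w ^ 2), mul_ne_zero hx₃ hmu,
    quat_iso a x₁ _ (m / x₃) (n / x₃) ha hx₁ ?_,
    quat_iso b x₂ _ (r * ms / x₃) (r * ns / x₃) hb hx₂ ?_,
    quat_iso (a * b) x₃ _ (u / (u ^ 2 - a * b * w ^ 2)) (w / (u ^ 2 - a * b * w ^ 2))
      (mul_ne_zero ha hb) hx₃ ?_⟩
  · field_simp
    linear_combination -hc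
  · subst hu hw
    field_simp
    linear_combination -hd
  · field_simp

/-- The cocycle computation on the cyclic vector `v`. -/
lemma operator_aux {k : Type} [Field k] (h2 : (2 : k) ≠ 0) (a b : k) (ha : a ≠ 0) (hb : b ≠ 0)
    (x₁ x₂ x₃ : k) (hx₁ : x₁ ≠ 0) (hx₂ : x₂ ≠ 0) (hx₃ : x₃ ≠ 0)
    {V : Type} [AddCommGroup V] [Module k V] (A B J Js : V →ₗ[k] V) (v : V)
    (hLI : ∀ e0 e1 e2 e3 : k, e0 • v + e1 • A v + e2 • B v + e3 • A (B v) = 0 →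
      e0 = 0 ∧ e1 = 0 ∧ e2 = 0 ∧ e3 = 0)
    (hA : ∀ w, A (A w) = a • w) (hB : ∀ w, B (B w) = b • w) (hBA : ∀ w, B (A w) = A (B w))
    (hJA : ∀ w, J (A w) = - A (J w)) (hJB : ∀ w, J (B w) = B (J w))
    (hKA : ∀ w, Js (A w) = A (Js w)) (hKB : ∀ w, Js (B w) = - B (Js w))
    (hJ : ∀ w, J (J w) = (x₁ * x₃) • w) (hJ' : ∀ w, Js (Js w) = (x₂ * x₃) • w)
    (hJJ' : ∀ w, J (Js w) = Js (J w))
    (hp : ∃ p0 p1 p2 p3 : k, J v = p0 • v + p1 • A v + p2 • B v + p3 • A (B v))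
    (hq : ∃ p0 p1 p2 p3 : k, Js v = p0 • v + p1 • A v + p2 • B v + p3 • A (B v)) :
    ∃ lam : k, lam ≠ 0 ∧
      Nonempty (ℍ[k, a, x₁] ≃ₐ[k] ℍ[k, a, lam]) ∧
      Nonempty (ℍ[k, b, x₂] ≃ₐ[k] ℍ[k, b, lam]) ∧
      Nonempty (ℍ[k, a * b, x₃] ≃ₐ[k] ℍ[k, a * b, lam]) := by
  obtain ⟨p0, p1, p2, p3, hp⟩ := hp
  obtain ⟨q0, q1, q2, q3, hq⟩ := hq
  have E1 := hJ v
  have E2 := hJ' v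
  have E3 := hJJ' v
  rw [hp] at E1
  rw [hq] at E2
  rw [hp, hq] at E3
  simp only [map_add, map_smul, hJA, hJB, hKA, hKB, hp, hq, hA, hB, hBA, map_neg] at E1 E2 E3
  obtain ⟨c0, -, c2, -⟩ := hLI (p0 ^ 2 - a * p1 ^ 2 + b * p2 ^ 2 - a * b * p3 ^ 2 - x₁ * x₃) 0
    (2 * (p0 * p2 - a * p1 * p3)) 0 (by linear_combination (norm := module) E1)
  obtain ⟨d0, d1, -, -⟩ := hLI (q0 ^ 2 + a * q1 ^ 2 - b * q2 ^ 2 - a * b * q3 ^ 2 - x₂ * x₃)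
    (2 * (q0 * q1 - b * q2 * q3)) 0 0 (by linear_combination (norm := module) E2)
  obtain ⟨u, w, m, n, rfl, rfl, rfl, rfl⟩ := factor_aux a p0 p1 p2 p3 ha
    (by linear_combination (mul_eq_zero.mp c2).resolve_left h2)
  obtain ⟨us, ws, ms, ns, rfl, rfl, rfl, rfl⟩ := factor_aux b q0 q2 q1 q3 hb
    (by linear_combination (mul_eq_zero.mp d1).resolve_left h2)
  obtain ⟨z0, z1, z2, z3⟩ := hLI (2 * a * b * ((w * us - u * ws) * (n * ns)))
    (2 * b * ((w * us - u * ws) * (m * ns)))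
    (2 * a * ((w * us - u * ws) * (n * ms)))
    (2 * ((w * us - u * ws) * (m * ms)))
    (by linear_combination (norm := module) E3)
  refine final_aux h2 a b ha hb x₁ x₂ x₃ hx₁ hx₂ hx₃ u w m n us ws ms ns ?_ ?_ ?_ ?_ ?_ ?_
  · linear_combination c0
  · linear_combination d0
  · exact (mul_eq_zero.mp z3).resolve_left h2
  · exact (mul_eq_zero.mp z2).resolve_left (mul_ne_zero h2 ha)
  · exact (mul_eq_zero.mp z1).resolve_left (mul_ne_zero h2 hb)
  · exact (mul_eq_zero.mp z0).resolve_left (mul_ne_zero (mul_ne_zero h2 ha) hb)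

/-- Freeness of the cyclic vector. -/
lemma indep_aux {k : Type} [Field k] (h2 : (2 : k) ≠ 0) (a b : k) (ha : a ≠ 0)
    (hsa : ¬∃ c : k, c ^ 2 = a) (hsb : ¬∃ c : k, c ^ 2 = b)
    (hsab : ¬∃ c : k, c ^ 2 = a * b)
    {V : Type} [AddCommGroup V] [Module k V] (A B : V →ₗ[k] V) (v : V) (hv : v ≠ 0)
    (hA : ∀ w, A (A w) = a • w) (hB : ∀ w, B (B w) = b • w) (hBA : ∀ w, B (A w) = A (B w))
    (e0 e1 e2 e3 : k) (h : e0 • v + e1 • A v + e2 • B v + e3 • A (B v) = 0) :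
    e0 = 0 ∧ e1 = 0 ∧ e2 = 0 ∧ e3 = 0 := by
  have norm_ne : ∀ x y : k, x ^ 2 - a * y ^ 2 = 0 → x = 0 ∧ y = 0 := by
    intro x y hxy
    have hy : y = 0 := by
      by_contra hy
      apply hsa
      refine ⟨x / y, ?_⟩
      field_simp
      linear_combination hxy
    subst hy
    simpa using hxy
  have ind2 : ∀ x y : k, x • v + y • A v = 0 → x = 0 ∧ y = 0 := by
    intro x y hxy
    have hA' := congrArg A hxy
    simp only [map_add, map_smul, hA, map_zero] at hA'
    have : (x ^ 2 - a * y ^ 2) • v = 0 := by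
      linear_combination (norm := module) x • hxy - y • hA'
    exact norm_ne x y ((smul_eq_zero.mp this).resolve_right hv)
  by_cases hN : e2 ^ 2 - a * e3 ^ 2 = 0
  · obtain ⟨rfl, rfl⟩ := norm_ne _ _ hN
    have := ind2 e0 e1 (by simpa using h)
    exact ⟨this.1, this.2, rfl, rfl⟩
  · exfalso
    set N := e2 ^ 2 - a * e3 ^ 2 with hNdef
    have hA' := congrArg A h
    simp only [map_add, map_smul, hA, map_zero] at hA'
    obtain ⟨X, Y, hXY⟩ : ∃ X Y : k, B v = X • v + Y • A v := by
      refine ⟨N⁻¹ * (a * e1 * e3 - e0 * e2), N⁻¹ * (e0 * e3 - e1 * e2), ?_⟩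
      have h1 : N • B v = (a * e1 * e3 - e0 * e2) • v + (e0 * e3 - e1 * e2) • A v := by
        rw [hNdef]
        linear_combination (norm := module) e2 • h - e3 • hA'
      have h3 : B v = N⁻¹ • (N • B v) := by rw [smul_smul, inv_mul_cancel₀ hN, one_smul]
      rw [h3, h1]
      module
    have hBB := hB v
    rw [hXY] at hBB
    simp only [map_add, map_smul, hBA, hXY, hA] at hBB
    obtain ⟨f0, f1⟩ := ind2 (X ^ 2 + a * Y ^ 2 - b) (2 * (X * Y))
      (by linear_combination (norm := module) hBB)
    rcases mul_eq_zero.mp ((mul_eq_zero.mp f1).resolve_left h2) with rfl | rfl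
    · exact hsab ⟨a * Y, by linear_combination a * f0⟩
    · exact hsb ⟨X, by linear_combination f0⟩

/-- The module-theoretic part: an 8-dimensional representation. -/
lemma rep_aux {k : Type} [Field k] (h2 : (2 : k) ≠ 0) (a b : k) (ha : a ≠ 0) (hb : b ≠ 0)
    (hsa : ¬∃ c : k, c ^ 2 = a) (hsb : ¬∃ c : k, c ^ 2 = b)
    (hsab : ¬∃ c : k, c ^ 2 = a * b)
    (x₁ x₂ x₃ : k) (hx₁ : x₁ ≠ 0) (hx₂ : x₂ ≠ 0) (hx₃ : x₃ ≠ 0)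
    {V : Type} [AddCommGroup V] [Module k V] [FiniteDimensional k V]
    (hV : Module.finrank k V = 8)
    (A B C J₁ J₂ J₃ : V →ₗ[k] V)
    (hA : ∀ w, A (A w) = a • w) (hB : ∀ w, B (B w) = b • w)
    (hC : ∀ w, C (C w) = (a * b) • w)
    (hBA : ∀ w, B (A w) = A (B w)) (hCA : ∀ w, C (A w) = A (C w))
    (hCB : ∀ w, C (B w) = B (C w))
    (h11 : ∀ w, J₁ (A w) = - A (J₁ w)) (h12 : ∀ w, J₁ (B w) = B (J₁ w))
    (h13 : ∀ w, J₁ (C w) = C (J₁ w))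
    (h21 : ∀ w, J₂ (A w) = A (J₂ w)) (h22 : ∀ w, J₂ (B w) = - B (J₂ w))
    (h23 : ∀ w, J₂ (C w) = C (J₂ w))
    (h31 : ∀ w, J₃ (A w) = A (J₃ w)) (h32 : ∀ w, J₃ (B w) = B (J₃ w))
    (h33 : ∀ w, J₃ (C w) = - C (J₃ w))
    (s1 : ∀ w, J₁ (J₁ w) = x₁ • w) (s2 : ∀ w, J₂ (J₂ w) = x₂ • w)
    (s3 : ∀ w, J₃ (J₃ w) = x₃ • w)
    (j12 : ∀ w, J₂ (J₁ w) = J₁ (J₂ w)) (j13 : ∀ w, J₃ (J₁ w) = J₁ (J₃ w))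
    (j23 : ∀ w, J₃ (J₂ w) = J₂ (J₃ w)) :
    ∃ lam : k, lam ≠ 0 ∧
      Nonempty (ℍ[k, a, x₁] ≃ₐ[k] ℍ[k, a, lam]) ∧
      Nonempty (ℍ[k, b, x₂] ≃ₐ[k] ℍ[k, b, lam]) ∧
      Nonempty (ℍ[k, a * b, x₃] ≃ₐ[k] ℍ[k, a * b, lam]) := by
  have hab := mul_ne_zero ha hb
  let P : Submodule k V := LinearMap.ker (A ∘ₗ B ∘ₗ C - (a * b) • LinearMap.id)
  have hP : ∀ w, w ∈ P ↔ A (B (C w)) = (a * b) • w := by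
    intro w
    simp [P, LinearMap.mem_ker, sub_eq_zero]
  have hJ1inj : Function.Injective J₁ := by
    rw [injective_iff_map_eq_zero]
    intro w hw
    have := s1 w
    rw [hw, map_zero] at this
    exact (smul_eq_zero.mp this.symm).resolve_left hx₁
  have hdisj : Disjoint P (P.map J₁) := by
    rw [Submodule.disjoint_def]
    rintro w hw ⟨z, hz, rfl⟩
    rw [hP] at hw
    have hz' := congrArg J₁ ((hP z).1 hz)
    simp only [h11, h12, h13, map_smul] at hz'
    have : (2 * (a * b)) • J₁ z = 0 := by
      linear_combination (norm := module) -hw - hz'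
    exact (smul_eq_zero.mp this).resolve_left (mul_ne_zero h2 hab)
  have hdim : Module.finrank k P ≤ 4 := by
    have h1 := Submodule.finrank_add_finrank_le_of_disjoint hdisj
    rw [← (Submodule.equivMapOfInjective J₁ hJ1inj P).finrank_eq] at h1
    omega
  obtain ⟨v, hvP, hv⟩ : ∃ v ∈ P, v ≠ 0 := by
    have : Nontrivial V := Module.nontrivial_of_finrank_pos (R := k) (by omega)
    obtain ⟨w, hw⟩ := exists_ne (0 : V)
    by_cases h0 : A (B (C w)) + (a * b) • w = 0
    · refine ⟨J₁ w, ?_, fun h => hw (hJ1inj (by simpa using h))⟩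
      rw [hP]
      have := congrArg J₁ h0
      simp only [map_add, h11, h12, h13, map_smul, map_zero] at this
      linear_combination (norm := module) -this
    · refine ⟨_, ?_, h0⟩
      rw [hP]
      simp only [map_add, map_smul, hCA, hCB, hC, hBA, hB, hA, smul_smul]
      module
  have hLI := indep_aux h2 a b ha hsa hsb hsab A B v hv hA hB hBA
  have hAP : ∀ w ∈ P, A w ∈ P := by
    intro w hw
    rw [hP] at hw ⊢
    rw [hCA, hBA, hw, map_smul]
  have hBP : ∀ w ∈ P, B w ∈ P := by
    intro w hw
    rw [hP] at hw ⊢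
    rw [hCB, ← hBA, hw, map_smul]
  have hspan : ∀ w ∈ P, ∃ p0 p1 p2 p3 : k,
      w = p0 • v + p1 • A v + p2 • B v + p3 • A (B v) := by
    let f : Fin 4 → V := ![v, A v, B v, A (B v)]
    have hf : LinearIndependent k f := by
      rw [Fintype.linearIndependent_iff]
      intro g hg
      simp only [Fin.sum_univ_four, f] at hg
      have := hLI (g 0) (g 1) (g 2) (g 3) (by simpa using hg)
      intro i
      fin_cases i
      · exact this.1
      · exact this.2.1
      · exact this.2.2.1
      · exact this.2.2.2
    have hle : Submodule.span k (Set.range f) ≤ P := by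
      rw [Submodule.span_le]
      rintro _ ⟨i, rfl⟩
      fin_cases i
      · exact hvP
      · exact hAP _ hvP
      · exact hBP _ hvP
      · exact hAP _ (hBP _ hvP)
    have heq : Submodule.span k (Set.range f) = P := by
      apply Submodule.eq_of_le_of_finrank_le hle
      rw [finrank_span_eq_card hf]
      simpa using hdim
    intro w hw
    rw [← heq, Submodule.mem_span_range_iff_exists_fun] at hw
    obtain ⟨c, hc⟩ := hw
    refine ⟨c 0, c 1, c 2, c 3, ?_⟩
    rw [← hc, Fin.sum_univ_four]
    simp [f]
  refine operator_aux h2 a b ha hb x₁ x₂ x₃ hx₁ hx₂ hx₃ A B (J₁ ∘ₗ J₃) (J₂ ∘ₗ J₃) v hLI hA hB hBA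
    ?_ ?_ ?_ ?_ ?_ ?_ ?_ ?_ ?_
  · intro w; simp [h31, h11]
  · intro w; simp [h32, h12]
  · intro w; simp [h31, h21]
  · intro w; simp [h32, h22]
  · intro w; simp [j13, s1, s3, smul_smul, mul_comm]
  · intro w; simp [j23, s2, s3, smul_smul, mul_comm]
  · intro w; simp [j13, j23, j12]
  · apply hspan
    have := (hP v).1 hvP
    rw [hP]
    have := congrArg J₁ (congrArg J₃ this)
    simp only [h31, h32, h33, h11, h12, h13, map_neg, map_smul, neg_neg] at this
    simpa using this
  · apply hspan
    have := (hP v).1 hvP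
    rw [hP]
    have := congrArg J₂ (congrArg J₃ this)
    simp only [h31, h32, h33, h21, h22, h23, map_neg, map_smul, neg_neg] at this
    simpa using this



/-- Common slot theorem for a biquadratic extension: if `char k ≠ 2`, none of `a, b, ab` is a
square, and the product of the quaternion algebras `(a, x₁)`, `(b, x₂)`, `(ab, x₃)` is split
(isomorphic to the `8×8` matrix algebra), then there is a common slot `λ ∈ k^×` with
`(a, x₁) ≅ (a, λ)`, `(b, x₂) ≅ (b, λ)`, `(ab, x₃) ≅ (ab, λ)`. -/
theorem statement16 (k : Type) [Field k] (hchar : (2 : k) ≠ 0)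
    (a b : k) (ha : a ≠ 0) (hb : b ≠ 0)
    (hsa : ¬∃ c : k, c ^ 2 = a) (hsb : ¬∃ c : k, c ^ 2 = b)
    (hsab : ¬∃ c : k, c ^ 2 = a * b)
    (x₁ x₂ x₃ : k) (hx₁ : x₁ ≠ 0) (hx₂ : x₂ ≠ 0) (hx₃ : x₃ ≠ 0)
    (hsplit : Nonempty
      (((ℍ[k, a, x₁] ⊗[k] ℍ[k, b, x₂]) ⊗[k] ℍ[k, a * b, x₃]) ≃ₐ[k]
        Matrix (Fin 8) (Fin 8) k)) :
    ∃ lam : k, lam ≠ 0 ∧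
      Nonempty (ℍ[k, a, x₁] ≃ₐ[k] ℍ[k, a, lam]) ∧
      Nonempty (ℍ[k, b, x₂] ≃ₐ[k] ℍ[k, b, lam]) ∧
      Nonempty (ℍ[k, a * b, x₃] ≃ₐ[k] ℍ[k, a * b, lam]) := by
  obtain ⟨φ⟩ := hsplit
  let i₁ : ℍ[k, a, x₁] := ⟨0, 1, 0, 0⟩
  let j₁ : ℍ[k, a, x₁] := ⟨0, 0, 1, 0⟩
  let i₂ : ℍ[k, b, x₂] := ⟨0, 1, 0, 0⟩
  let j₂ : ℍ[k, b, x₂] := ⟨0, 0, 1, 0⟩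
  let i₃ : ℍ[k, a * b, x₃] := ⟨0, 1, 0, 0⟩
  let j₃ : ℍ[k, a * b, x₃] := ⟨0, 0, 1, 0⟩
  have ii₁ : i₁ * i₁ = a • 1 := by ext <;> simp [i₁]
  have ii₂ : i₂ * i₂ = b • 1 := by ext <;> simp [i₂]
  have ii₃ : i₃ * i₃ = (a * b) • 1 := by ext <;> simp [i₃]
  have jj₁ : j₁ * j₁ = x₁ • 1 := by ext <;> simp [j₁]
  have jj₂ : j₂ * j₂ = x₂ • 1 := by ext <;> simp [j₂]
  have jj₃ : j₃ * j₃ = x₃ • 1 := by ext <;> simp [j₃]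
  have ji₁ : j₁ * i₁ = -(i₁ * j₁) := by ext <;> simp [i₁, j₁]
  have ji₂ : j₂ * i₂ = -(i₂ * j₂) := by ext <;> simp [i₂, j₂]
  have ji₃ : j₃ * i₃ = -(i₃ * j₃) := by ext <;> simp [i₃, j₃]
  let ρ : ((ℍ[k, a, x₁] ⊗[k] ℍ[k, b, x₂]) ⊗[k] ℍ[k, a * b, x₃]) →ₐ[k]
      Module.End k (Fin 8 → k) := (Matrix.toLinAlgEquiv' : _ ≃ₐ[k] _).toAlgHom.comp φ.toAlgHom
  let ρ₁ : ℍ[k, a, x₁] →ₐ[k] Module.End k (Fin 8 → k) :=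
    ρ.comp (Algebra.TensorProduct.includeLeft.comp Algebra.TensorProduct.includeLeft)
  let ρ₂ : ℍ[k, b, x₂] →ₐ[k] Module.End k (Fin 8 → k) :=
    ρ.comp (Algebra.TensorProduct.includeLeft.comp Algebra.TensorProduct.includeRight)
  let ρ₃ : ℍ[k, a * b, x₃] →ₐ[k] Module.End k (Fin 8 → k) :=
    ρ.comp Algebra.TensorProduct.includeRight
  have c12 : ∀ x y w, ρ₂ y (ρ₁ x w) = ρ₁ x (ρ₂ y w) := by
    intro x y w
    rw [← Module.End.mul_apply, ← Module.End.mul_apply]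
    congr 1
    simp only [ρ₁, ρ₂, AlgHom.comp_apply, ← map_mul]
    congr 1
    simp
  have c13 : ∀ x y w, ρ₃ y (ρ₁ x w) = ρ₁ x (ρ₃ y w) := by
    intro x y w
    rw [← Module.End.mul_apply, ← Module.End.mul_apply]
    congr 1
    simp only [ρ₁, ρ₃, AlgHom.comp_apply, ← map_mul]
    congr 1
    simp
  have c23 : ∀ x y w, ρ₃ y (ρ₂ x w) = ρ₂ x (ρ₃ y w) := by
    intro x y w
    rw [← Module.End.mul_apply, ← Module.End.mul_apply]
    congr 1
    simp only [ρ₂, ρ₃, AlgHom.comp_apply, ← map_mul]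
    congr 1
    simp
  refine rep_aux hchar a b ha hb hsa hsb hsab x₁ x₂ x₃ hx₁ hx₂ hx₃ (V := Fin 8 → k) (by simp)
    (ρ₁ i₁) (ρ₂ i₂) (ρ₃ i₃) (ρ₁ j₁) (ρ₂ j₂) (ρ₃ j₃)
    ?_ ?_ ?_ (c12 _ _) (c13 _ _) (c23 _ _)
    ?_ (fun w => (c12 _ _ w).symm) (fun w => (c13 _ _ w).symm)
    (c12 _ _) ?_ (fun w => (c23 _ _ w).symm)
    (c13 _ _) (c23 _ _) ?_
    ?_ ?_ ?_ (c12 _ _) (c13 _ _) (c23 _ _)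
  · intro w; rw [← Module.End.mul_apply, ← map_mul, ii₁, map_smul, map_one]; rfl
  · intro w; rw [← Module.End.mul_apply, ← map_mul, ii₂, map_smul, map_one]; rfl
  · intro w; rw [← Module.End.mul_apply, ← map_mul, ii₃, map_smul, map_one]; rfl
  · intro w; rw [← Module.End.mul_apply, ← map_mul, ji₁, map_neg, map_mul]; rfl
  · intro w; rw [← Module.End.mul_apply, ← map_mul, ji₂, map_neg, map_mul]; rfl
  · intro w; rw [← Module.End.mul_apply, ← map_mul, ji₃, map_neg, map_mul]; rfl
  · intro w; rw [← Module.End.mul_apply, ← map_mul, jj₁, map_smul, map_one]; rfl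
  · intro w; rw [← Module.End.mul_apply, ← map_mul, jj₂, map_smul, map_one]; rfl
  · intro w; rw [← Module.End.mul_apply, ← map_mul, jj₃, map_smul, map_one]; rfl
end
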